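/- Consider a clause gadget, and fix for each of its three handles e(c_1), e(c_2), e(c_3) whether its weight 2.5 is rounded up (to 3) or down (to 2). The clause gadget admits a path-oblivious 1-rounding extending this choice if and only if at least one of the three handles is rounded down. Moreover, whenever a path-oblivious 1-rounding extending the choice exists, a strong 1-rounding extending the choice exists. -/

import Mathlib

open SimpleGraph

noncomputable def wWeight {V : Type*} {G : SimpleGraph V} (w : V → V → ℝ) {u v : V}
    (p : G.Walk u v) : ℝ :=
  (p.darts.map (fun d => w d.toProd.1 d.toProd.2)).sum

def IsShortestPath {V : Type*} {G : SimpleGraph V} (w : V → V → ℝ) {u v : V}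
    (p : G.Walk u v) : Prop :=
  p.IsPath ∧ ∀ q : G.Walk u v, wWeight w p ≤ wWeight w q

def PathObliviousRounding {V : Type*} (G : SimpleGraph V) (w : V → V → ℝ) (wt : V → V → ℕ)
    (ε : ℝ) : Prop :=
  ∀ (u v : V) (p : G.Walk u v), IsShortestPath w p →
    |wWeight (fun a b => (wt a b : ℝ)) p - wWeight w p| < ε

def WeakRounding {V : Type*} (G : SimpleGraph V) (w : V → V → ℝ) (wt : V → V → ℕ)
    (ε : ℝ) : Prop :=
  PathObliviousRounding G w wt ε ∧
  ∀ (u v : V) (p : G.Walk u v), IsShortestPath w p →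
    IsShortestPath (fun a b => (wt a b : ℝ)) p

def StrongRounding {V : Type*} (G : SimpleGraph V) (w : V → V → ℝ) (wt : V → V → ℕ)
    (ε : ℝ) : Prop :=
  WeakRounding G w wt ε ∧
  ∀ (u v : V) (p : G.Walk u v), IsShortestPath (fun a b => (wt a b : ℝ)) p →
    IsShortestPath w p

/-! The clause gadget: a nine-cycle (vertices `0,…,8`), knob vertices `9,10,11`
attached by handles to every third cycle vertex (`0,3,6`), and a centre vertex `12`
joined to all nine cycle vertices. -/

/-- The `s`-th cycle vertex. -/
def cyc (s : Fin 9) : Fin 13 := ⟨s.val, by omega⟩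

/-- The `t`-th knob vertex. -/
def knob (t : Fin 3) : Fin 13 := ⟨9 + t.val, by omega⟩

/-- The centre vertex. -/
def ctr : Fin 13 := 12

/-- Nonagon (cycle) edges, of weight `3.6`. -/
def cycleRel (a b : Fin 13) : Prop := ∃ s : Fin 9, a = cyc s ∧ b = cyc (s + 1)

/-- Handle edges, of weight `2.5`: knob `t` is attached to cycle vertex `3t`. -/
def handleRel (a b : Fin 13) : Prop :=
  ∃ t : Fin 3, a = knob t ∧ b = cyc ⟨3 * t.val, by omega⟩

/-- Centre edges, of weight `6`. -/
def centreRel (a b : Fin 13) : Prop := ∃ s : Fin 9, a = ctr ∧ b = cyc s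

def clauseGadget : SimpleGraph (Fin 13) :=
  SimpleGraph.fromRel (fun a b => cycleRel a b ∨ handleRel a b ∨ centreRel a b)

open Classical in
/-- The weight function of the clause gadget. -/
noncomputable def clauseW : Fin 13 → Fin 13 → ℝ := fun a b =>
  if handleRel a b ∨ handleRel b a then 2.5
  else if cycleRel a b ∨ cycleRel b a then 3.6
  else if centreRel a b ∨ centreRel b a then 6
  else 0

/-- `wt` rounds the three handles according to `choice` (`true` = up to `3`,
`false` = down to `2`). -/
def HandleChoice (wt : Fin 13 → Fin 13 → ℕ) (choice : Fin 3 → Bool) : Prop :=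
  ∀ t : Fin 3, wt (knob t) (cyc ⟨3 * t.val, by omega⟩) = if choice t then 3 else 2

/-- `D` is the table of distances of `G` when every edge `ab` has length `D a b`. -/
structure IsDistTable {V : Type*} (G : SimpleGraph V) (D : V → V → ℕ) : Prop where
  self : ∀ v, D v v = 0
  triangle : ∀ u x v, G.Adj u x → D u v ≤ D u x + D x v
  step : ∀ u v, u ≠ v → ∃ x, G.Adj u x ∧ 0 < D u x ∧ D u x + D x v = D u v

section DistTable

variable {V : Type*} {G : SimpleGraph V} {D D' : V → V → ℕ} {w w' : V → V → ℝ} {c c' : ℝ}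

@[simp] lemma wWeight_nil (w : V → V → ℝ) (u : V) : wWeight w (Walk.nil : G.Walk u u) = 0 := by
  simp [wWeight]

@[simp] lemma wWeight_cons (w : V → V → ℝ) {u x v : V} (h : G.Adj u x) (q : G.Walk x v) :
    wWeight w (Walk.cons h q) = w u x + wWeight w q := by
  simp [wWeight]

lemma IsDistTable.le_wWeight (hD : IsDistTable G D) (hc : 0 < c)
    (hw : ∀ a b, G.Adj a b → w a b = c * D a b) {u v : V} (p : G.Walk u v) :
    c * D u v ≤ wWeight w p := by
  induction p with
  | nil => simp [hD.self]
  | @cons u x v h q ih =>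
    have ht : (D u v : ℝ) ≤ D u x + D x v := by exact_mod_cast hD.triangle u x v h
    rw [wWeight_cons, hw _ _ h]
    nlinarith

lemma IsDistTable.exists_wWeight_eq (hD : IsDistTable G D)
    (hw : ∀ a b, G.Adj a b → w a b = c * D a b) (u v : V) :
    ∃ p : G.Walk u v, wWeight w p = c * D u v := by
  induction hn : D u v using Nat.strong_induction_on generalizing u with
  | _ n ih =>
    by_cases huv : u = v
    · subst huv
      exact ⟨Walk.nil, by simp [← hn, hD.self]⟩
    · obtain ⟨x, hx, hpos, hsum⟩ := hD.step u v huv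
      obtain ⟨q, hq⟩ := ih (D x v) (by omega) x rfl
      refine ⟨Walk.cons hx q, ?_⟩
      rw [wWeight_cons, hq, hw _ _ hx, ← hn, ← hsum]
      push_cast
      ring

lemma IsDistTable.isShortestPath_iff (hD : IsDistTable G D) (hc : 0 < c)
    (hw : ∀ a b, G.Adj a b → w a b = c * D a b) {u v : V} (p : G.Walk u v) :
    IsShortestPath w p ↔ p.IsPath ∧ wWeight w p = c * D u v := by
  refine and_congr_right fun _ => ⟨fun h => ?_, fun h q => h ▸ hD.le_wWeight hc hw q⟩
  obtain ⟨q, hq⟩ := hD.exists_wWeight_eq hw u v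
  exact le_antisymm (hq ▸ h q) (hD.le_wWeight hc hw p)

lemma IsDistTable.wWeight_cons_eq_iff (hD : IsDistTable G D) (hc : 0 < c)
    (hw : ∀ a b, G.Adj a b → w a b = c * D a b) {u x v : V} (h : G.Adj u x) (q : G.Walk x v) :
    wWeight w (Walk.cons h q) = c * D u v ↔
      D u x + D x v = D u v ∧ wWeight w q = c * D x v := by
  have ht : (D u v : ℝ) ≤ D u x + D x v := by exact_mod_cast hD.triangle u x v h
  have hq := hD.le_wWeight hc hw q
  rw [wWeight_cons, hw _ _ h, ← @Nat.cast_inj ℝ]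
  push_cast
  constructor
  · intro heq
    have hle : (D u x : ℝ) + D x v ≤ D u v := le_of_mul_le_mul_left (by linarith) hc
    have htight := le_antisymm hle ht
    rw [← htight] at heq
    exact ⟨htight, by linarith⟩
  · rintro ⟨htight, hq⟩
    rw [hq, ← htight]
    ring

/-- Two distance tables with the same tight edges have the same minimum-weight walks. -/
lemma IsDistTable.wWeight_eq_iff (hD : IsDistTable G D) (hD' : IsDistTable G D')
    (hc : 0 < c) (hc' : 0 < c') (hw : ∀ a b, G.Adj a b → w a b = c * D a b)
    (hw' : ∀ a b, G.Adj a b → w' a b = c' * D' a b)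
    (htight : ∀ u x v, G.Adj u x →
      (D u x + D x v = D u v ↔ D' u x + D' x v = D' u v)) {u v : V} (p : G.Walk u v) :
    wWeight w p = c * D u v ↔ wWeight w' p = c' * D' u v := by
  induction p with
  | nil => simp [hD.self, hD'.self]
  | cons h q ih =>
    rw [hD.wWeight_cons_eq_iff hc hw, hD'.wWeight_cons_eq_iff hc' hw', ih, htight _ _ _ h]

lemma IsDistTable.strongRounding (hD : IsDistTable G D) (hD' : IsDistTable G D')
    (hc : 0 < c) (hw : ∀ a b, G.Adj a b → w a b = c * D a b)
    (htight : ∀ u x v, G.Adj u x →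
      (D u x + D x v = D u v ↔ D' u x + D' x v = D' u v)) {ε : ℝ}
    (hclose : ∀ u v, |(D' u v : ℝ) - c * D u v| < ε) : StrongRounding G w D' ε := by
  have hw' : ∀ a b, G.Adj a b → (fun a b => (D' a b : ℝ)) a b = 1 * D' a b := by simp
  have hweight {u v : V} (p : G.Walk u v) :=
    hD.wWeight_eq_iff hD' hc one_pos hw hw' htight p
  have hiff {u v : V} (p : G.Walk u v) :
      IsShortestPath w p ↔ IsShortestPath (fun a b => (D' a b : ℝ)) p := by
    rw [hD.isShortestPath_iff hc hw, hD'.isShortestPath_iff one_pos hw', hweight]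
  refine ⟨⟨fun u v p hp => ?_, fun u v p => (hiff p).1⟩, fun u v p => (hiff p).2⟩
  have hp := ((hD.isShortestPath_iff hc hw p).1 hp).2
  rw [hp, (hweight p).1 hp, one_mul]
  exact hclose u v

end DistTable

instance : DecidableRel cycleRel := fun _ _ => inferInstanceAs (Decidable (∃ _, _))

instance : DecidableRel handleRel := fun _ _ => inferInstanceAs (Decidable (∃ _, _))

instance : DecidableRel centreRel := fun _ _ => inferInstanceAs (Decidable (∃ _, _))

/-- Arithmetic description of the edges of the clause gadget, in one of their orientations. -/
def gadgetArc (a b : ℕ) : Bool :=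
  Nat.blt b 9 && (Nat.beq a 12 || Nat.beq (3 * a) (27 + b) ||
    (Nat.blt a 9 && Nat.beq b ((a + 1) % 9)))

lemma clauseGadget_adj_iff (a b : Fin 13) :
    clauseGadget.Adj a b ↔ (gadgetArc a b || gadgetArc b a) = true := by
  have key : ∀ a b : Fin 13, (a ≠ b ∧ ((cycleRel a b ∨ handleRel a b ∨ centreRel a b) ∨
      (cycleRel b a ∨ handleRel b a ∨ centreRel b a))) ↔
      (gadgetArc a b || gadgetArc b a) = true := by
    decide +kernel
  exact key a b

instance : DecidableRel clauseGadget.Adj := fun a b =>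
  decidable_of_iff _ (clauseGadget_adj_iff a b).symm

/-- Length of the arc of `k` edges of the nonagon that starts upwards from `i`, where `e s` is the
length of the edge between the cycle vertices `s` and `s + 1`. -/
def arcLength (e : Fin 9 → ℕ) (i : Fin 9) : ℕ → ℕ
  | 0 => 0
  | k + 1 => arcLength e i k + e (Fin.ofNat 9 (i.val + k))

/-- The cycle vertex to which a cycle or knob vertex belongs. -/
def hub (v : Fin 13) : Fin 9 :=
  if v.val < 9 then Fin.ofNat 9 v.val else Fin.ofNat 9 (3 * (v.val - 9))

/-- Distance of a cycle or knob vertex from its hub, when the handles have lengths `h`. -/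
def stem (h : Fin 3 → ℕ) (v : Fin 13) : ℕ :=
  if 9 ≤ v.val ∧ v.val < 12 then h (Fin.ofNat 3 (v.val - 9)) else 0

/-- Distances in the clause gadget with cycle edges of lengths `e`, handles of lengths `h` and
centre edges of length `c`, when shortest paths use an arc of at most three cycle edges if
possible and pass through the centre otherwise. -/
def gadgetDist (e : Fin 9 → ℕ) (h : Fin 3 → ℕ) (c : ℕ) (u v : Fin 13) : ℕ :=
  if u = v then 0
  else stem h u + stem h v +
    if u = ctr ∨ v = ctr then c
    else if (hub v - hub u).val ≤ 3 then arcLength e (hub u) (hub v - hub u).val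
    else if (hub u - hub v).val ≤ 3 then arcLength e (hub v) (hub u - hub v).val
    else 2 * c

/-- Ten times the distances in the clause gadget. -/
def clauseDist : Fin 13 → Fin 13 → ℕ := gadgetDist (fun _ => 36) (fun _ => 25) 60

/-- The cycle edges between two consecutive hubs are rounded to `3, 4, 3` if both handles are
rounded up and to `4, 3, 4` otherwise. -/
def roundedEdge (choice : Fin 3 → Bool) (s : Fin 9) : ℕ :=
  let t := Fin.ofNat 3 (s.val / 3)
  if (choice t && choice (t + 1)) = decide (s.val % 3 = 1) then 4 else 3

/-- A rounding of the clause gadget that extends the given choice for the handles. -/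
def roundedDist (choice : Fin 3 → Bool) : Fin 13 → Fin 13 → ℕ :=
  gadgetDist (roundedEdge choice) (fun t => if choice t then 3 else 2) 6

lemma clauseW_eq_clauseDist (a b : Fin 13) (hab : clauseGadget.Adj a b) :
    clauseW a b = 1 / 10 * clauseDist a b := by
  have key : ∀ a b, clauseGadget.Adj a b → clauseDist a b =
      if handleRel a b ∨ handleRel b a then 25
      else if cycleRel a b ∨ cycleRel b a then 36
      else if centreRel a b ∨ centreRel b a then 60 else 0 := by
    decide +kernel
  rw [key a b hab, clauseW]
  split_ifs <;> norm_num

lemma isDistTable_clauseDist : IsDistTable clauseGadget clauseDist where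
  self := by decide +kernel
  triangle := by decide +kernel
  step := by decide +kernel

lemma forall_choice {P : (Fin 3 → Bool) → Prop} (h : ∀ a b c, P ![a, b, c]) :
    ∀ choice, P choice := by
  intro choice
  convert h (choice 0) (choice 1) (choice 2)
  ext t
  fin_cases t <;> rfl

lemma isDistTable_roundedDist (choice : Fin 3 → Bool) (h : ∃ t, choice t = false) :
    IsDistTable clauseGadget (roundedDist choice) where
  self := by revert choice; refine forall_choice ?_; decide +kernel
  triangle := by revert choice; refine forall_choice ?_; decide +kernel
  step := by revert choice; refine forall_choice ?_; decide +kernel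

lemma roundedDist_comm (choice : Fin 3 → Bool) (a b : Fin 13) :
    roundedDist choice a b = roundedDist choice b a := by
  revert a b choice; refine forall_choice ?_; decide +kernel

lemma handleChoice_roundedDist (choice : Fin 3 → Bool) :
    HandleChoice (roundedDist choice) choice := by
  unfold HandleChoice
  revert choice; refine forall_choice ?_; decide +kernel

lemma clauseDist_tight_iff (choice : Fin 3 → Bool) (h : ∃ t, choice t = false) :
    ∀ u x v, clauseGadget.Adj u x →
      (clauseDist u x + clauseDist x v = clauseDist u v ↔
        roundedDist choice u x + roundedDist choice x v = roundedDist choice u v) := by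
  revert choice; refine forall_choice ?_; decide +kernel

lemma abs_roundedDist_sub_lt (choice : Fin 3 → Bool) (h : ∃ t, choice t = false)
    (u v : Fin 13) : |(roundedDist choice u v : ℝ) - 1 / 10 * clauseDist u v| < 1 := by
  have key : 10 * roundedDist choice u v < clauseDist u v + 10 ∧
      clauseDist u v < 10 * roundedDist choice u v + 10 := by
    revert u v choice; refine forall_choice ?_; decide +kernel
  have h₁ : (10 * roundedDist choice u v : ℝ) < clauseDist u v + 10 := by exact_mod_cast key.1
  have h₂ : (clauseDist u v : ℝ) < 10 * roundedDist choice u v + 10 := by exact_mod_cast key.2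
  rw [abs_lt]
  constructor <;> linarith

lemma strongRounding_roundedDist (choice : Fin 3 → Bool) (h : ∃ t, choice t = false) :
    StrongRounding clauseGadget clauseW (roundedDist choice) 1 :=
  isDistTable_clauseDist.strongRounding (isDistTable_roundedDist choice h) (by norm_num)
    clauseW_eq_clauseDist (clauseDist_tight_iff choice h) (abs_roundedDist_sub_lt choice h)

lemma abs_wWeight_sub_lt_of_rounding {wt : Fin 13 → Fin 13 → ℕ}
    (hr : PathObliviousRounding clauseGadget clauseW wt 1) {u v : Fin 13}
    (p : clauseGadget.Walk u v) (hp : p.support.Nodup)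
    (hd : (p.darts.map fun d => clauseDist d.toProd.1 d.toProd.2).sum = clauseDist u v) :
    |wWeight (fun a b => (wt a b : ℝ)) p - 1 / 10 * clauseDist u v| < 1 := by
  have hsum : wWeight clauseW p = 1 / 10 * clauseDist u v := by
    rw [← hd, Nat.cast_list_sum, List.map_map, ← List.sum_map_mul_left, wWeight]
    congr 1
    exact List.map_congr_left fun d _ => clauseW_eq_clauseDist _ _ d.adj
  rw [← hsum]
  exact hr u v p ((isDistTable_clauseDist.isShortestPath_iff (by norm_num)
    clauseW_eq_clauseDist p).2 ⟨p.isPath_def.2 hp, hsum⟩)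

lemma two_step_bound_of_rounding {wt : Fin 13 → Fin 13 → ℕ}
    (hr : PathObliviousRounding clauseGadget clauseW wt 1) {u x v : Fin 13}
    (hux : clauseGadget.Adj u x) (hxv : clauseGadget.Adj x v) (huv : u ≠ v)
    (hd : clauseDist u x + clauseDist x v = clauseDist u v) (hd' : clauseDist u v = 72) :
    7 ≤ wt u x + wt x v := by
  have h := abs_wWeight_sub_lt_of_rounding hr (.cons hux (.cons hxv .nil))
    (by simp [huv, hux.ne, hxv.ne]) (by simp [hd])
  simp only [wWeight_cons, wWeight_nil, hd', abs_lt] at h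
  have h' : (6 : ℝ) < wt u x + wt x v := by norm_num at h; linarith [h.1]
  exact_mod_cast h'

lemma knob_to_knob_bound_of_rounding {wt : Fin 13 → Fin 13 → ℕ}
    (hr : PathObliviousRounding clauseGadget clauseW wt 1) {k a b c d l : Fin 13}
    (h₁ : clauseGadget.Adj k a) (h₂ : clauseGadget.Adj a b) (h₃ : clauseGadget.Adj b c)
    (h₄ : clauseGadget.Adj c d) (h₅ : clauseGadget.Adj d l) (hn : [k, a, b, c, d, l].Nodup)
    (hd : clauseDist k a + (clauseDist a b + (clauseDist b c + (clauseDist c d +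
      clauseDist d l))) = clauseDist k l) (hd' : clauseDist k l = 158) :
    wt k a + (wt a b + (wt b c + (wt c d + wt d l))) ≤ 16 := by
  have h := abs_wWeight_sub_lt_of_rounding hr
    (.cons h₁ (.cons h₂ (.cons h₃ (.cons h₄ (.cons h₅ .nil))))) hn (by simpa using hd)
  simp only [wWeight_cons, wWeight_nil, hd', abs_lt] at h
  have h' : (wt k a + (wt a b + (wt b c + (wt c d + wt d l))) : ℝ) < 17 := by
    norm_num at h; linarith [h.2]
  exact Nat.lt_succ_iff.1 (by exact_mod_cast h')

lemma exists_handle_down_of_rounding {choice : Fin 3 → Bool} {wt : Fin 13 → Fin 13 → ℕ}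
    (hsymm : ∀ a b, wt a b = wt b a) (hwt : HandleChoice wt choice)
    (hr : PathObliviousRounding clauseGadget clauseW wt 1) : ∃ t, choice t = false := by
  by_contra! hup
  have hk (t : Fin 3) : wt (knob t) (cyc ⟨3 * t.val, by omega⟩) = 3 := by
    simpa [hup t] using hwt t
  have k₀ : wt 9 0 = 3 := hk 0
  have k₁ : wt 10 3 = 3 := hk 1
  have k₂ : wt 11 6 = 3 := hk 2
  have h₀₁₂ := two_step_bound_of_rounding hr (u := 0) (x := 1) (v := 2)
    (by decide +kernel) (by decide +kernel) (by decide) (by decide +kernel) (by decide +kernel)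
  have h₂₃₄ := two_step_bound_of_rounding hr (u := 2) (x := 3) (v := 4)
    (by decide +kernel) (by decide +kernel) (by decide) (by decide +kernel) (by decide +kernel)
  have h₄₅₆ := two_step_bound_of_rounding hr (u := 4) (x := 5) (v := 6)
    (by decide +kernel) (by decide +kernel) (by decide) (by decide +kernel) (by decide +kernel)
  have s₀ := knob_to_knob_bound_of_rounding hr (k := 9) (a := 0) (b := 1) (c := 2) (d := 3)
    (l := 10) (by decide +kernel) (by decide +kernel) (by decide +kernel) (by decide +kernel)
    (by decide +kernel) (by decide) (by decide +kernel) (by decide +kernel)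
  have s₁ := knob_to_knob_bound_of_rounding hr (k := 10) (a := 3) (b := 4) (c := 5) (d := 6)
    (l := 11) (by decide +kernel) (by decide +kernel) (by decide +kernel) (by decide +kernel)
    (by decide +kernel) (by decide) (by decide +kernel) (by decide +kernel)
  rw [hsymm 3 10] at s₀
  rw [hsymm 6 11] at s₁
  omega

/-- Fix for each handle of the clause gadget whether it is rounded up (to `3`) or down (to `2`).
The gadget admits a path-oblivious `1`-rounding extending this choice iff at least one handle
is rounded down; and whenever a path-oblivious `1`-rounding extending the choice exists, a
strong `1`-rounding extending the choice exists. -/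
theorem clause_gadget_rounding (choice : Fin 3 → Bool) :
    ((∃ wt : Fin 13 → Fin 13 → ℕ, (∀ a b, wt a b = wt b a) ∧ HandleChoice wt choice ∧
        PathObliviousRounding clauseGadget clauseW wt 1) ↔ ∃ t, choice t = false) ∧
    ((∃ wt : Fin 13 → Fin 13 → ℕ, (∀ a b, wt a b = wt b a) ∧ HandleChoice wt choice ∧
        PathObliviousRounding clauseGadget clauseW wt 1) →
      ∃ wt : Fin 13 → Fin 13 → ℕ, (∀ a b, wt a b = wt b a) ∧ HandleChoice wt choice ∧
        StrongRounding clauseGadget clauseW wt 1) := by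
  have hdown : (∃ wt : Fin 13 → Fin 13 → ℕ, (∀ a b, wt a b = wt b a) ∧ HandleChoice wt choice ∧
      PathObliviousRounding clauseGadget clauseW wt 1) → ∃ t, choice t = false :=
    fun ⟨_, hsymm, hwt, hr⟩ => exists_handle_down_of_rounding hsymm hwt hr
  refine ⟨⟨hdown, fun h => ?_⟩, fun h => ?_⟩
  · exact ⟨roundedDist choice, roundedDist_comm choice, handleChoice_roundedDist choice,
      (strongRounding_roundedDist choice h).1.1⟩
  · exact ⟨roundedDist choice, roundedDist_comm choice, handleChoice_roundedDist choice,
      strongRounding_roundedDist choice (hdown h)⟩
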